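/- Let G be a countable monoid, R a ring, and A an Artinian R-module. Let Σ ⊆ A^G be a subshift, closed in the prodiscrete topology, such that for every finite subset E ⊆ G the restriction Σ_E is an R-submodule of A^E. Let τ_1, …, τ_n : Σ → Σ be pairwise commuting G-equivariant maps (τ_i(g ⋆ x) = g ⋆ τ_i(x) for all g, x), and suppose that for each i there exist a finite subset M_i ⊆ G and an R-linear map μ_i : Σ_{M_i} → A such that τ_i(x)(g) = μ_i((g ⋆ x)|_{M_i}) for all x ∈ Σ and g ∈ G. Let Γ be the monoid of maps Σ → Σ generated by τ_1, …, τ_n under composition. Then the valuation action T(τ, x) := τ(x) of Γ on Σ has the shadowing property. -/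

import Mathlib

/-- The right shift action: `(g ⋆ x)(h) = x (h * g)`. -/
def shiftMul {G A : Type*} [Mul G] (g : G) (x : G → A) : G → A := fun h => x (h * g)

/-- An exhaustion of a countable monoid: `E 0 = ∅`, increasing, covering `G`,
with each `E n` finite. -/
def IsExhaustion {G : Type*} (E : ℕ → Finset G) : Prop :=
  E 0 = ∅ ∧ (∀ n, E n ⊆ E (n + 1)) ∧ ∀ g : G, ∃ n, g ∈ E n

open Classical in
/-- The standard Hamming metric associated with the exhaustion `E`:
`d(x,y) = 2^{-n}` with `n = sup {k | x = y on E k}`, and `0` if `x = y`. -/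
noncomputable def hamming {G A : Type*} (E : ℕ → Finset G) (x y : G → A) : ℝ :=
  if x = y then 0 else (2 : ℝ)⁻¹ ^ sSup {k : ℕ | ∀ g ∈ E k, x g = y g}

/-- `(S, d, δ)`-pseudo-orbit of the action `T` of `Γ` on `X`. -/
def IsPseudoOrbit {Γ X : Type*} [Monoid Γ] (T : Γ → X → X) (S : Set Γ)
    (d : X → X → ℝ) (δ : ℝ) (o : Γ → X) : Prop :=
  ∀ σ ∈ S, ∀ t : Γ, d (T σ (o t)) (o (σ * t)) < δ

/-- The `(S, d)`-shadowing property of the action `T` of `Γ` on `X`. -/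
def HasShadowing {Γ X : Type*} [Monoid Γ] (T : Γ → X → X) (S : Set Γ)
    (d : X → X → ℝ) : Prop :=
  ∀ ε > (0 : ℝ), ∃ δ > (0 : ℝ), ∀ o : Γ → X, IsPseudoOrbit T S d δ o →
    ∃ x : X, ∀ t : Γ, d (T t x) (o t) < ε

/-- The intrinsic shadowing property for an action of a finitely generated monoid `Γ`
on a subshift `X ⊆ A^G` (given via the inclusion `ι : X → (G → A)`): the
`(S, d|_X)`-shadowing property holds for every finite generating set `S` of `Γ`
and every standard Hamming metric `d` on `A^G`. -/
def HasShadowingProperty {Γ G A X : Type*} [Monoid Γ] [Monoid G]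
    (ι : X → (G → A)) (T : Γ → X → X) : Prop :=
  ∀ S : Set Γ, S.Finite → Submonoid.closure S = ⊤ →
    ∀ E : ℕ → Finset G, IsExhaustion E →
      HasShadowing T S fun x y => hamming E (ι x) (ι y)

/-! ### Antitone maps out of a well-quasi-order -/

/-- An antitone map from a well-quasi-order to a well-founded order attains all its values
on a finite set, at points below any prescribed one. -/
theorem Antitone.exists_finset_le_eq {W P : Type*} [PartialOrder W] [WellQuasiOrderedLE W]
    [PartialOrder P] [WellFoundedLT P] {f : W → P} (hf : Antitone f) :
    ∃ F : Finset W, ∀ u, ∃ v ∈ F, v ≤ u ∧ f v = f u := by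
  have hfin : {u | ∀ v < u, f v ≠ f u}.Finite := by
    by_contra hinf
    let e := Set.Infinite.natEmbedding _ hinf
    obtain ⟨g, hg⟩ := (wellQuasiOrdered_le (α := W)).exists_monotone_subseq fun k => (e k : W)
    have hlt : ∀ k, f (e (g (k + 1))) < f (e (g k)) := by
      intro k
      have hle := hg k (k + 1) k.le_succ
      have hne : (e (g k) : W) ≠ e (g (k + 1)) := by
        intro h
        have := g.injective (e.injective (Subtype.ext h))
        omega
      exact lt_of_le_of_ne (hf hle) ((e (g (k + 1))).2 _ (lt_of_le_of_ne hle hne)).symm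
    exact not_strictAnti_of_wellFoundedLT (fun k => f (e (g k))) (strictAnti_nat_of_succ_lt hlt)
  refine ⟨hfin.toFinset, fun u => ?_⟩
  induction u using WellFoundedLT.induction with
  | ind u ih =>
    by_cases hu : ∀ v < u, f v ≠ f u
    · exact ⟨u, by simpa using hu, le_rfl, rfl⟩
    · push Not at hu
      obtain ⟨v, hvu, hv⟩ := hu
      obtain ⟨w, hw, hwv, h⟩ := ih v hvu
      exact ⟨w, hw, hwv.trans hvu.le, h.trans hv⟩

/-! ### Linear shift spaces over `ℕⁿ` are determined by finite patterns -/

theorem finite_setOf_toDegLex_le {n : ℕ} (u : Fin n →₀ ℕ) :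
    {v : Fin n →₀ ℕ | toDegLex v ≤ toDegLex u}.Finite :=
  (Finsupp.finite_of_degree_le u.degree).subset fun _ hv => Finsupp.DegLex.monotone_degree hv

/-- The values at `u` of the elements of `Y` which vanish at all indices smaller than `u`
in the graded lexicographic order. -/
def Submodule.lowestCoeff {R B : Type*} [Ring R] [AddCommGroup B] [Module R B] {n : ℕ}
    (Y : Submodule R ((Fin n →₀ ℕ) → B)) (u : Fin n →₀ ℕ) : Submodule R B where
  carrier := {b | ∃ y ∈ Y, (∀ v, toDegLex v < toDegLex u → y v = 0) ∧ y u = b}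
  zero_mem' := ⟨0, Y.zero_mem, fun _ _ => rfl, rfl⟩
  add_mem' := by
    rintro _ _ ⟨y, hy, hy0, rfl⟩ ⟨z, hz, hz0, rfl⟩
    exact ⟨y + z, Y.add_mem hy hz, fun v hv => by simp [hy0 v hv, hz0 v hv], rfl⟩
  smul_mem' := by
    rintro c _ ⟨y, hy, hy0, rfl⟩
    exact ⟨c • y, Y.smul_mem c hy, fun v hv => by simp [hy0 v hv], rfl⟩

theorem Submodule.antitone_lowestCoeff {R B : Type*} [Ring R] [AddCommGroup B] [Module R B]
    {n : ℕ} {Y : Submodule R ((Fin n →₀ ℕ) → B)}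
    (hY : ∀ y ∈ Y, ∀ s, (fun u => y (u + s)) ∈ Y) : Antitone Y.lowestCoeff := by
  rintro u w huw _ ⟨y, hy, hy0, rfl⟩
  obtain ⟨s, rfl⟩ := exists_add_of_le huw
  refine ⟨_, hY y hy s, fun v hv => hy0 _ ?_, rfl⟩
  simpa only [toDegLex_add] using add_lt_add_left hv _

/-- A shift-invariant submodule of `B ^ (ℕ ^ n)`, with `B` Artinian, is of finite type: if all
translates of the `D`-pattern of `y` occur in `Y`, then all finite patterns of `y` do. -/
theorem Submodule.exists_finset_forall_pattern {R B : Type*} [Ring R] [AddCommGroup B]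
    [Module R B] [IsArtinian R B] {n : ℕ} (Y : Submodule R ((Fin n →₀ ℕ) → B))
    (hY : ∀ y ∈ Y, ∀ s, (fun u => y (u + s)) ∈ Y) :
    ∃ D : Finset (Fin n →₀ ℕ), ∀ y : (Fin n →₀ ℕ) → B,
      (∀ s, ∃ z ∈ Y, ∀ u ∈ D, y (u + s) = z u) →
        ∀ K : Finset (Fin n →₀ ℕ), ∃ z ∈ Y, ∀ u ∈ K, y u = z u := by
  obtain ⟨F, hF⟩ := (antitone_lowestCoeff hY).exists_finset_le_eq
  refine ⟨F.biUnion fun v => (finite_setOf_toDegLex_le v).toFinset, fun y hy K => ?_⟩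
  have hlow : ∀ v ∈ F, ∀ s, ∃ z ∈ Y, ∀ u, toDegLex u ≤ toDegLex v → y (u + s) = z u := by
    intro v hv s
    obtain ⟨z, hz, hyz⟩ := hy s
    exact ⟨z, hz, fun u hu => hyz u (Finset.mem_biUnion.2 ⟨v, hv, by simpa using hu⟩)⟩
  have correct : ∀ u, (∃ z ∈ Y, ∀ v, toDegLex v < toDegLex u → y v = z v) →
      ∃ z ∈ Y, ∀ v, toDegLex v ≤ toDegLex u → y v = z v := by
    rintro u ⟨z, hz, hyz⟩
    obtain ⟨v, hvF, hvu, hv⟩ := hF u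
    obtain ⟨s, rfl⟩ := exists_add_of_le hvu
    obtain ⟨z', hz', hyz'⟩ := hlow v hvF s
    have hmem : y (v + s) - z (v + s) ∈ Y.lowestCoeff v := by
      refine ⟨z' - fun u => z (u + s), Y.sub_mem hz' (hY z hz s), fun w hw => ?_, ?_⟩
      · have hws : toDegLex (w + s) < toDegLex (v + s) := by
          simpa only [toDegLex_add] using add_lt_add_left hw _
        simp [← hyz' w hw.le, hyz _ hws]
      · simp [← hyz' v le_rfl]
    rw [hv] at hmem
    obtain ⟨x, hx, hx0, hxe⟩ := hmem
    refine ⟨z + x, Y.add_mem hz hx, fun w hw => ?_⟩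
    rcases hw.lt_or_eq with hw | hw
    · simp [hx0 w hw, hyz w hw]
    · rw [toDegLex_inj] at hw
      subst hw
      simp [hxe]
  have hle : ∀ u : DegLex (Fin n →₀ ℕ), ∃ z ∈ Y, ∀ v, toDegLex v ≤ u → y v = z v := by
    intro u
    induction u using WellFoundedLT.induction with
    | ind u ih =>
      refine correct (ofDegLex u) ?_
      rcases (Set.Iio u).eq_empty_or_nonempty with h | h
      · exact ⟨0, Y.zero_mem, fun v hv => ((Set.eq_empty_iff_forall_notMem.1 h) _ hv).elim⟩
      · have hfin : (Set.Iio u).Finite :=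
          (finite_setOf_toDegLex_le (ofDegLex u)).subset
            fun (v : DegLex (Fin n →₀ ℕ)) (hv : v < u) => hv.le
        obtain ⟨w, hw, hmax⟩ := Set.exists_max_image _ id hfin h
        obtain ⟨z, hz, hyz⟩ := ih w hw
        exact ⟨z, hz, fun v hv => hyz v (hmax _ hv)⟩
  obtain ⟨u, hu⟩ := (K.image toDegLex).exists_le
  obtain ⟨z, hz, hyz⟩ := hle u
  exact ⟨z, hz, fun v hv => hyz v (hu _ (Finset.mem_image_of_mem _ hv))⟩

/-! ### Linear compactness -/

/-- A decreasing sequence of nonempty affine subspaces of an Artinian module has a common point. -/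
theorem AffineSubspace.exists_forall_mem_of_antitone {R B : Type*} [Ring R] [AddCommGroup B]
    [Module R B] [IsArtinian R B] {C : ℕ → AffineSubspace R B} (hC : Antitone C)
    (hne : ∀ k, (C k : Set B).Nonempty) : ∃ b, ∀ k, b ∈ C k := by
  obtain ⟨N, hN⟩ := IsArtinian.monotone_stabilizes
    (⟨fun k => OrderDual.toDual (C k).direction, fun _ _ h => AffineSubspace.direction_le (hC h)⟩ :
      ℕ →o (Submodule R B)ᵒᵈ)
  obtain ⟨b, hb⟩ := hne N
  refine ⟨b, fun k => ?_⟩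
  rcases le_total k N with h | h
  · exact hC h hb
  · rwa [eq_of_direction_eq_of_nonempty_of_le (hN k h).symm (hne k) (hC h)]

/-- A decreasing sequence of nonempty affine subspaces of `A ^ G` has a common limit point. -/
theorem AffineSubspace.exists_forall_pattern_of_antitone {R A G : Type*} [Ring R]
    [AddCommGroup A] [Module R A] [IsArtinian R A] [Countable G]
    {C : ℕ → AffineSubspace R (G → A)} (hC : Antitone C)
    (hne : ∀ k, (C k : Set (G → A)).Nonempty) :
    ∃ x : G → A, ∀ k (F : Finset G), ∃ y ∈ C k, ∀ g ∈ F, y g = x g := by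
  rcases isEmpty_or_nonempty G with hG | hG
  · refine ⟨isEmptyElim, fun k F => ?_⟩
    obtain ⟨y, hy⟩ := hne k
    exact ⟨y, hy, fun g => isEmptyElim g⟩
  obtain ⟨e, he⟩ := exists_surjective_nat G
  let St := {C : ℕ → AffineSubspace R (G → A) // Antitone C ∧ ∀ k, (C k : Set (G → A)).Nonempty}
  have step : ∀ (g : G) (s : St), ∃ (t : St) (a : A),
      (∀ k, t.1 k ≤ s.1 k) ∧ ∀ k, ∀ y ∈ t.1 k, y g = a := by
    rintro g ⟨C, hC, hne⟩
    let p : (G → A) →ᵃ[R] A := (LinearMap.proj g : (G → A) →ₗ[R] A).toAffineMap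
    obtain ⟨a, ha⟩ := exists_forall_mem_of_antitone (C := fun k => (C k).map p)
      (fun _ _ h => AffineSubspace.map_mono p (hC h)) (fun k => (hne k).image p)
    refine ⟨⟨fun k => C k ⊓ (AffineSubspace.mk' a (⊥ : Submodule R A)).comap p,
      fun _ _ h => inf_le_inf_right _ (hC h), fun k => ?_⟩, a, fun k => inf_le_left, fun k y hy => ?_⟩
    · obtain ⟨y, hy, hya⟩ := ha k
      exact ⟨y, hy, by simpa [AffineSubspace.mem_mk', sub_eq_zero] using hya⟩
    · simpa [p, AffineSubspace.mem_mk', sub_eq_zero] using hy.2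
  choose next val hnext hval using step
  let s : ℕ → St := fun j => Nat.rec ⟨C, hC, hne⟩ (fun j s => next (e j) s) j
  have hs : ∀ k, Antitone fun j => (s j).1 k := fun k =>
    antitone_nat_of_succ_le fun j => hnext (e j) (s j) k
  choose idx hidx using he
  refine ⟨fun g => val g (s (idx g)), fun k F => ?_⟩
  obtain ⟨m, hm⟩ := (F.image idx).exists_le
  obtain ⟨y, hy⟩ := (s (m + 1)).2.2 k
  refine ⟨y, hs k (Nat.zero_le (m + 1)) hy, fun g hg => ?_⟩
  have h1 : y ∈ (s (idx g + 1)).1 k :=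
    hs k (Nat.succ_le_succ (hm _ (Finset.mem_image_of_mem _ hg))) hy
  have h2 := hval (e (idx g)) (s (idx g)) k y h1
  rwa [hidx g] at h2

/-! ### The Hamming metric -/

theorem IsExhaustion.monotone {G : Type*} {E : ℕ → Finset G} (hE : IsExhaustion E) :
    Monotone E :=
  monotone_nat_of_le_succ hE.2.1

theorem IsExhaustion.exists_subset {G : Type*} {E : ℕ → Finset G} (hE : IsExhaustion E)
    (F : Finset G) : ∃ k, F ⊆ E k := by
  choose idx hidx using hE.2.2
  obtain ⟨m, hm⟩ := (F.image idx).exists_le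
  exact ⟨m, fun g hg => hE.monotone (hm _ (Finset.mem_image_of_mem _ hg)) (hidx g)⟩

theorem IsExhaustion.bddAbove_of_ne {G A : Type*} {E : ℕ → Finset G} (hE : IsExhaustion E)
    {x y : G → A} (hxy : x ≠ y) : BddAbove {k : ℕ | ∀ g ∈ E k, x g = y g} := by
  obtain ⟨g, hg⟩ := Function.ne_iff.1 hxy
  obtain ⟨m, hm⟩ := hE.2.2 g
  refine ⟨m, fun k hk => ?_⟩
  by_contra! h
  exact hg (hk g (hE.monotone h.le hm))

theorem exists_forall_eq_of_hamming_lt {G A : Type*} {E : ℕ → Finset G} (hE : IsExhaustion E)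
    (F : Finset G) :
    ∃ δ > (0 : ℝ), ∀ x y : G → A, hamming E x y < δ → ∀ g ∈ F, x g = y g := by
  obtain ⟨k, hk⟩ := hE.exists_subset F
  refine ⟨(2 : ℝ)⁻¹ ^ k, by positivity, fun x y h g hg => ?_⟩
  by_cases hxy : x = y
  · rw [hxy]
  rw [hamming, if_neg hxy,
    pow_lt_pow_iff_right_of_lt_one₀ (by norm_num) (by norm_num)] at h
  have hmem := Nat.sSup_mem ⟨0, by simp [hE.1]⟩ (hE.bddAbove_of_ne hxy)
  exact hmem g (hE.monotone h.le (hk hg))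

theorem exists_hamming_lt_of_forall_eq {G A : Type*} {E : ℕ → Finset G} (hE : IsExhaustion E)
    {ε : ℝ} (hε : 0 < ε) :
    ∃ F : Finset G, ∀ x y : G → A, (∀ g ∈ F, x g = y g) → hamming E x y < ε := by
  obtain ⟨k, hk⟩ := exists_pow_lt_of_lt_one hε (by norm_num : (2 : ℝ)⁻¹ < 1)
  refine ⟨E k, fun x y h => ?_⟩
  by_cases hxy : x = y
  · rwa [hamming, if_pos hxy]
  rw [hamming, if_neg hxy]
  refine lt_of_le_of_lt ?_ hk
  exact pow_le_pow_of_le_one (by norm_num) (by norm_num)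
    (le_csSup (hE.bddAbove_of_ne hxy) h)

/-! ### Closed sets in the prodiscrete topology -/

theorem mem_of_isClosed_of_forall_pattern {G A : Type*} [TopologicalSpace A]
    [DiscreteTopology A] {X : Set (G → A)} (hX : IsClosed X) {x : G → A}
    (h : ∀ F : Finset G, ∃ y ∈ X, ∀ g ∈ F, y g = x g) : x ∈ X := by
  rw [← hX.closure_eq, mem_closure_iff]
  intro o ho hxo
  obtain ⟨F, u, hu, hsub⟩ := isOpen_pi_iff.1 ho x hxo
  obtain ⟨y, hy, hyx⟩ := h F
  exact ⟨y, hsub fun g hg => by rw [hyx g hg]; exact (hu g hg).2, hy⟩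

theorem exists_submodule_coe_eq_of_isClosed {G R A : Type*} [Ring R] [AddCommGroup A]
    [Module R A] [TopologicalSpace A] [DiscreteTopology A] {X : Set (G → A)} (hX : IsClosed X)
    (hmod : ∀ E : Finset G, ∃ N : Submodule R (↥(E : Set G) → A),
      (N : Set (↥(E : Set G) → A)) =
        {q | ∃ x ∈ X, ∀ e : ↥(E : Set G), q e = x ↑e}) :
    ∃ V : Submodule R (G → A), (V : Set (G → A)) = X := by
  choose N hN using hmod
  have hmem : ∀ E q, q ∈ N E ↔ ∃ x ∈ X, ∀ e : ↥(E : Set G), q e = x ↑e := fun E q => by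
    rw [← SetLike.mem_coe, hN]; rfl
  have hX' : ∀ x, (∀ E : Finset G, (fun e : ↥(E : Set G) => x ↑e) ∈ N E) → x ∈ X := by
    intro x hx
    refine mem_of_isClosed_of_forall_pattern hX fun F => ?_
    obtain ⟨y, hy, hxy⟩ := (hmem F _).1 (hx F)
    exact ⟨y, hy, fun g hg => (hxy ⟨g, hg⟩).symm⟩
  have hres : ∀ x ∈ X, ∀ E : Finset G, (fun e : ↥(E : Set G) => x ↑e) ∈ N E :=
    fun x hx E => (hmem E _).2 ⟨x, hx, fun _ => rfl⟩
  exact ⟨{ carrier := X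
           zero_mem' := hX' _ fun E => (N E).zero_mem
           add_mem' := fun hx hy => hX' _ fun E => (N E).add_mem (hres _ hx E) (hres _ hy E)
           smul_mem' := fun c _ hx => hX' _ fun E => (N E).smul_mem c (hres _ hx E) }, rfl⟩

/-! ### Shadowing -/

/-- A self-map of a set of configurations is locally determined if every finite part of the
image depends only on a finite part of the argument. -/
def IsLocallyDetermined {G A : Type*} {X : Set (G → A)} (f : X → X) : Prop :=
  ∀ F : Finset G, ∃ F' : Finset G, ∀ x y : X, (∀ g ∈ F', x.1 g = y.1 g) →
    ∀ g ∈ F, (f x).1 g = (f y).1 g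

theorem IsLocallyDetermined.id {G A : Type*} {X : Set (G → A)} :
    IsLocallyDetermined (fun x : X => x) :=
  fun F => ⟨F, fun _ _ h => h⟩

theorem IsLocallyDetermined.comp {G A : Type*} {X : Set (G → A)} {f f' : X → X}
    (hf : IsLocallyDetermined f) (hf' : IsLocallyDetermined f') :
    IsLocallyDetermined fun x => f (f' x) := by
  intro F
  obtain ⟨F₁, h₁⟩ := hf F
  obtain ⟨F₂, h₂⟩ := hf' F₁
  exact ⟨F₂, fun x y h => h₁ _ _ (h₂ x y h)⟩

/-- A pseudo-orbit with small enough defect follows the action of any given element of the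
monoid, up to the chosen precision. -/
theorem exists_pseudoOrbit_forall_eq {Γ G A : Type*} [Monoid Γ] {X : Set (G → A)}
    {T : Γ → X → X} (hone : ∀ x, T 1 x = x) (hmul : ∀ s t x, T (s * t) x = T s (T t x))
    (hloc : ∀ t, IsLocallyDetermined (T t)) {S : Set Γ} (hS : Submonoid.closure S = ⊤)
    {E : ℕ → Finset G} (hE : IsExhaustion E) (d : Γ) (F : Finset G) :
    ∃ δ > (0 : ℝ), ∀ o : Γ → X,
      IsPseudoOrbit T S (fun x y => hamming E x.1 y.1) δ o →
        ∀ t, ∀ g ∈ F, (o (d * t)).1 g = (T d (o t)).1 g := by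
  have hd : d ∈ Submonoid.closure S := hS ▸ Submonoid.mem_top d
  induction hd using Submonoid.closure_induction generalizing F with
  | mem σ hσ =>
    obtain ⟨δ, hδ, h⟩ := exists_forall_eq_of_hamming_lt (A := A) hE F
    exact ⟨δ, hδ, fun o ho t g hg => (h _ _ (ho σ hσ t) g hg).symm⟩
  | one => exact ⟨1, one_pos, fun o _ t g _ => by rw [one_mul, hone]⟩
  | mul a b _ _ iha ihb =>
    obtain ⟨F', hF'⟩ := hloc a F
    obtain ⟨δ₁, hδ₁, h₁⟩ := iha F
    obtain ⟨δ₂, hδ₂, h₂⟩ := ihb F'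
    refine ⟨min δ₁ δ₂, lt_min hδ₁ hδ₂, fun o ho t g hg => ?_⟩
    rw [mul_assoc, h₁ o (fun σ hσ t => (ho σ hσ t).trans_le (min_le_left _ _)) _ g hg, hmul]
    exact hF' _ _ (h₂ o (fun σ hσ t => (ho σ hσ t).trans_le (min_le_right _ _)) t) g hg

/-- A monoid homomorphism from `ℕⁿ` onto a commutative monoid generated by `n` elements. -/
theorem exists_surjective_finsupp_of_closure_range {Γ : Type*} [Monoid Γ] {n : ℕ}
    {γ : Fin n → Γ} (hγ : Submonoid.closure (Set.range γ) = ⊤)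
    (hcomm : ∀ a b : Γ, a * b = b * a) :
    ∃ φ : Multiplicative (Fin n →₀ ℕ) →* Γ, Function.Surjective φ := by
  let _ : CommMonoid Γ := { (inferInstance : Monoid Γ) with mul_comm := hcomm }
  let φ : Multiplicative (Fin n →₀ ℕ) →* Γ :=
    AddMonoidHom.toMultiplicativeLeft
      (Finsupp.liftAddHom fun i => (multiplesHom (Additive Γ)) (Additive.ofMul (γ i)))
  refine ⟨φ, MonoidHom.mrange_eq_top.1 (top_le_iff.1 ?_)⟩
  rw [← hγ, Submonoid.closure_le]
  rintro _ ⟨i, rfl⟩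
  refine ⟨Multiplicative.ofAdd (Finsupp.single i 1), ?_⟩
  simp [φ]

theorem hasShadowingProperty_of_linear {G R A Γ : Type*} [Monoid G] [Countable G] [Ring R]
    [AddCommGroup A] [Module R A] [IsArtinian R A] [TopologicalSpace A] [DiscreteTopology A]
    (V : Submodule R (G → A)) (hV : IsClosed (V : Set (G → A))) [Monoid Γ] {n : ℕ}
    (φ : Multiplicative (Fin n →₀ ℕ) →* Γ) (hφ : Function.Surjective φ)
    (T : Γ →* Module.End R V)
    (hloc : ∀ t, IsLocallyDetermined (X := (V : Set (G → A))) (T t)) :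
    HasShadowingProperty (fun x : V => x.1) (fun t (x : V) => T t x) := by
  intro S _ hS E hE ε hε
  obtain ⟨F, hF⟩ := exists_hamming_lt_of_forall_eq (A := A) hE hε
  let ψ : (Fin n →₀ ℕ) → Γ := fun u => φ (Multiplicative.ofAdd u)
  have hψadd : ∀ u v, ψ (u + v) = ψ u * ψ v := fun u v => by simp [ψ]
  let L : V →ₗ[R] ((Fin n →₀ ℕ) → F → A) :=
    LinearMap.pi fun u => LinearMap.pi fun e => LinearMap.proj e.1 ∘ₗ V.subtype ∘ₗ T (ψ u)
  have hL : ∀ x u e, L x u e = (T (ψ u) x).1 e.1 := fun _ _ _ => rfl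
  obtain ⟨D, hD⟩ := Submodule.exists_finset_forall_pattern (LinearMap.range L) (by
    rintro _ ⟨x, rfl⟩ s
    refine ⟨T (ψ s) x, ?_⟩
    ext u e
    rw [hL, hL, hψadd, map_mul, Module.End.mul_apply])
  choose δ hδ hδo using fun d => exists_pseudoOrbit_forall_eq (X := (V : Set (G → A)))
    (T := fun t x => T t x) (fun x => by simp) (fun s t x => by simp) hloc hS hE d F
  obtain ⟨η, hη, hηD⟩ : ∃ η > 0, ∀ u ∈ D, η ≤ δ (ψ u) := by
    rcases D.eq_empty_or_nonempty with rfl | hne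
    · exact ⟨1, one_pos, by simp⟩
    · obtain ⟨u, -, hu⟩ := D.exists_min_image (fun u => δ (ψ u)) hne
      exact ⟨δ (ψ u), hδ _, hu⟩
  refine ⟨η, hη, fun o ho => ?_⟩
  have hpat := hD (fun u e => (o (ψ u)).1 e.1) fun s => by
    refine ⟨_, ⟨o (ψ s), rfl⟩, fun u hu => ?_⟩
    ext e
    rw [hL, hψadd]
    exact hδo (ψ u) o (fun σ hσ t => (ho σ hσ t).trans_le (hηD u hu)) (ψ s) e.1 e.2
  obtain ⟨enum, henum⟩ := exists_surjective_nat (Fin n →₀ ℕ)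
  let C : ℕ → AffineSubspace R (G → A) := fun k =>
    { carrier := {x | ∃ h : x ∈ V, ∀ i < k, ∀ e : F,
        (T (ψ (enum i)) ⟨x, h⟩).1 e.1 = (o (ψ (enum i))).1 e.1}
      smul_vsub_vadd_mem' := by
        rintro c p₁ p₂ p₃ ⟨h₁, hp₁⟩ ⟨h₂, hp₂⟩ ⟨h₃, hp₃⟩
        refine ⟨V.add_mem (V.smul_mem c (V.sub_mem h₁ h₂)) h₃, fun i hi e => ?_⟩
        have : (⟨c • (p₁ -ᵥ p₂) +ᵥ p₃, V.add_mem (V.smul_mem c (V.sub_mem h₁ h₂)) h₃⟩ : V) =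
            c • (⟨p₁, h₁⟩ - ⟨p₂, h₂⟩) + ⟨p₃, h₃⟩ := rfl
        rw [this, map_add, map_smul, map_sub]
        simp [hp₁ i hi e, hp₂ i hi e, hp₃ i hi e] }
  have hC : Antitone C := by
    rintro k l hkl x ⟨h, hx⟩
    exact ⟨h, fun i hi => hx i (hi.trans_le hkl)⟩
  have hne : ∀ k, (C k : Set (G → A)).Nonempty := by
    intro k
    obtain ⟨_, ⟨x, rfl⟩, hx⟩ := hpat ((Finset.range k).image enum)
    refine ⟨x.1, x.2, fun i hi e => ?_⟩
    have := hx (enum i) (Finset.mem_image_of_mem _ (Finset.mem_range.2 hi))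
    exact (congrFun this e).symm
  obtain ⟨x, hx⟩ := AffineSubspace.exists_forall_pattern_of_antitone hC hne
  have hxV : x ∈ V := mem_of_isClosed_of_forall_pattern hV fun F => by
    obtain ⟨y, ⟨hy, -⟩, hyx⟩ := hx 0 F
    exact ⟨y, hy, hyx⟩
  refine ⟨⟨x, hxV⟩, fun t => hF _ _ fun g hg => ?_⟩
  obtain ⟨u, rfl⟩ := hφ t
  obtain ⟨i, hi⟩ := henum (Multiplicative.toAdd u)
  have hiu : ψ (enum i) = φ u := by simp [ψ, hi]
  obtain ⟨F', hF'⟩ := hloc (φ u) F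
  obtain ⟨y, ⟨hy, hyo⟩, hyx⟩ := hx (i + 1) F'
  have h := hyo i i.lt_succ_self ⟨g, hg⟩
  rw [hiu] at h
  exact (hF' ⟨x, hxV⟩ ⟨y, hy⟩ (fun g hg => (hyx g hg).symm) g hg).trans h

theorem statement18 {G : Type*} [Monoid G] [Countable G]
    {R : Type*} [Ring R] {A : Type*} [AddCommGroup A] [Module R A] [IsArtinian R A]
    [TopologicalSpace A] [DiscreteTopology A]
    (Sgm : Set (G → A))
    (hshift : ∀ g : G, ∀ x ∈ Sgm, shiftMul g x ∈ Sgm)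
    (hclosed : IsClosed Sgm)
    (hmod : ∀ E : Finset G, ∃ N : Submodule R (↥(E : Set G) → A),
      (N : Set (↥(E : Set G) → A)) =
        {q | ∃ x ∈ Sgm, ∀ e : ↥(E : Set G), q e = x ↑e})
    {n : ℕ} (τ : Fin n → ↥Sgm → ↥Sgm)
    (hcomm : ∀ i j x, τ i (τ j x) = τ j (τ i x))
    (hequiv : ∀ i (g : G) (x : ↥Sgm),
      (τ i ⟨shiftMul g x.1, hshift g x.1 x.2⟩).1 = shiftMul g (τ i x).1)
    (hloc : ∀ i, ∃ (M : Finset G) (μ : (↥(M : Set G) → A) → A),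
      (∀ p q : ↥(M : Set G) → A,
        (∃ x ∈ Sgm, ∀ m : ↥(M : Set G), p m = x ↑m) →
        (∃ x ∈ Sgm, ∀ m : ↥(M : Set G), q m = x ↑m) →
        μ (p + q) = μ p + μ q) ∧
      (∀ (c : R) (p : ↥(M : Set G) → A),
        (∃ x ∈ Sgm, ∀ m : ↥(M : Set G), p m = x ↑m) →
        μ (c • p) = c • μ p) ∧
      ∀ (x : ↥Sgm) (g : G), (τ i x).1 g = μ fun m : ↥(M : Set G) => x.1 (↑m * g)) :
    HasShadowingProperty (fun x : ↥Sgm => x.1)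
      (fun f : ↥(Submonoid.closure (M := Function.End ↥Sgm) (Set.range fun i => τ i)) =>
        fun x : ↥Sgm => f.1 x) := by
  classical
  obtain ⟨V, rfl⟩ := exists_submodule_coe_eq_of_isClosed hclosed hmod
  have hadd : ∀ i (x y : V), τ i (x + y) = (τ i x : V) + (τ i y : V) := by
    intro i x y
    obtain ⟨M, μ, hμ, -, h⟩ := hloc i
    ext g
    refine (h (x + y) g).trans ?_
    refine (hμ _ _ ⟨_, hshift g _ x.2, fun _ => rfl⟩ ⟨_, hshift g _ y.2, fun _ => rfl⟩).trans ?_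
    exact congrArg₂ (· + ·) (h x g).symm (h y g).symm
  have hsmul : ∀ i (c : R) (x : V), τ i (c • x) = c • (τ i x : V) := by
    intro i c x
    obtain ⟨M, μ, -, hμ, h⟩ := hloc i
    ext g
    refine (h (c • x) g).trans ?_
    refine (hμ c _ ⟨_, hshift g _ x.2, fun _ => rfl⟩).trans ?_
    exact congrArg (c • ·) (h x g).symm
  have hlocal : ∀ i, IsLocallyDetermined (τ i) := by
    intro i F
    obtain ⟨M, μ, -, -, h⟩ := hloc i
    refine ⟨Finset.image₂ (· * ·) M F, fun x y hxy g hg => ?_⟩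
    rw [h x g, h y g]
    congr 1
    funext m
    exact hxy _ (Finset.mem_image₂_of_mem m.2 hg)
  let Γ := Submonoid.closure (M := Function.End ↥(V : Set (G → A))) (Set.range fun i => τ i)
  have hcommΓ : ∀ a b : Γ, a * b = b * a := by
    have := Submonoid.isMulCommutative_closure
      (Function.End ↥(V : Set (G → A))) (s := Set.range fun i => τ i) (by
        rintro _ ⟨i, rfl⟩ _ ⟨j, rfl⟩
        exact funext (hcomm i j))
    exact this.is_comm.comm
  have hlin : ∀ t : Γ, (∀ x y : V, t.1 (x + y) = (t.1 x : V) + (t.1 y : V)) ∧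
      (∀ (c : R) (x : V), t.1 (c • x) = c • (t.1 x : V)) ∧ IsLocallyDetermined t.1 := by
    rintro ⟨t, ht⟩
    induction ht using Submonoid.closure_induction with
    | mem t ht =>
      obtain ⟨i, rfl⟩ := ht
      exact ⟨hadd i, hsmul i, hlocal i⟩
    | one => exact ⟨fun _ _ => rfl, fun _ _ => rfl, .id⟩
    | mul a b _ _ iha ihb =>
      exact ⟨fun x y => (congrArg a (ihb.1 x y)).trans (iha.1 _ _),
        fun c x => (congrArg a (ihb.2.1 c x)).trans (iha.2.1 _ _), iha.2.2.comp ihb.2.2⟩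
  let T : Γ →* Module.End R V :=
    { toFun := fun t => { toFun := t.1, map_add' := (hlin t).1, map_smul' := (hlin t).2.1 }
      map_one' := rfl
      map_mul' := fun _ _ => rfl }
  obtain ⟨φ, hφ⟩ := exists_surjective_finsupp_of_closure_range
    (γ := fun i => (⟨τ i, Submonoid.subset_closure ⟨i, rfl⟩⟩ : Γ))
    (by
      have h := Submonoid.closure_closure_coe_preimage
        (M := Function.End ↥(V : Set (G → A))) (s := Set.range fun i => τ i)
      rw [← h]
      congr 1
      ext t
      exact exists_congr fun i => Subtype.ext_iff) hcommΓ
  exact hasShadowingProperty_of_linear V hclosed φ hφ T fun t => (hlin t).2.2
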